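/- Let α ∈ (0,1), ε > 0 small, and let ℱ(x) = F(α, α; 1+α; x), 𝒢(x) = (ℱ(x)−1)/x. Then ∫_0^1 x^{−1+α+ε} 𝒢(x) dx = (1/(1−α−ε)) [ 1 − (α/(1−ε)) Γ(α+ε)Γ(1−α)/Γ(ε) − (απ/sin(απ))(1 − α/(1−ε)) ]. -/

import Mathlib

open Real

/-- The Gauss hypergeometric function `F(a,b;c;x) = ∑ (a)_n (b)_n x^n / ((c)_n n!)`,
with Pochhammer symbol `(a)_n = Γ(a+n)/Γ(a)`. -/
noncomputable def hypergeomF (a b c x : ℝ) : ℝ :=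
  ∑' n : ℕ, (Real.Gamma (a + n) / Real.Gamma a) * (Real.Gamma (b + n) / Real.Gamma b) /
    ((Real.Gamma (c + n) / Real.Gamma c) * n.factorial) * x ^ n

open MeasureTheory Filter Topology

noncomputable def pc (a : ℝ) (n : ℕ) : ℝ := Real.Gamma (a + n) / Real.Gamma a / n.factorial

lemma pc_zero {a : ℝ} (h : 0 < a) : pc a 0 = 1 := by
  have := (Real.Gamma_pos_of_pos h).ne'
  simp [pc, this]

lemma pc_pos {a : ℝ} (h : 0 < a) (n : ℕ) : 0 < pc a n := by
  have := Real.Gamma_pos_of_pos h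
  have := Real.Gamma_pos_of_pos (show 0 < a + n by positivity)
  have : 0 < (n.factorial : ℝ) := by positivity
  unfold pc
  positivity

lemma pc_succ {a : ℝ} (h : 0 < a) (n : ℕ) : pc a (n + 1) * (n + 1) = pc a n * (a + n) := by
  have h1 := (Real.Gamma_pos_of_pos h).ne'
  have h2 : Real.Gamma (a + (n + 1 : ℕ)) = (a + n) * Real.Gamma (a + n) := by
    rw [← Real.Gamma_add_one (by positivity)]; push_cast; ring_nf
  have : (n.factorial : ℝ) ≠ 0 := by positivity
  unfold pc
  rw [h2, Nat.factorial_succ]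
  push_cast
  field_simp

lemma pc_eq_choose {a : ℝ} (h : 0 < a) (n : ℕ) : Ring.choose (a + n - 1) n = pc a n := by
  rw [← Ring.multichoose_eq]
  have h1 := Ring.factorial_nsmul_multichoose_eq_ascPochhammer a n
  rw [Polynomial.ascPochhammer_smeval_eq_eval] at h1
  have h2 : ∀ n : ℕ, (ascPochhammer ℝ n).eval a = pc a n * n.factorial := by
    intro n
    induction n with
    | zero => simp [pc_zero h]
    | succ k ih =>
      rw [ascPochhammer_succ_eval, ih, Nat.factorial_succ]
      push_cast
      linear_combination (- (k.factorial : ℝ)) * pc_succ h k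
  rw [h2, nsmul_eq_mul] at h1
  have : (n.factorial : ℝ) ≠ 0 := by positivity
  exact mul_left_cancel₀ this (by linarith)

lemma hasSum_pc {a : ℝ} (h : 0 < a) {x : ℝ} (hx0 : 0 < x) (hx1 : x < 1) :
    HasSum (fun n => pc a n * x ^ n) ((1 - x) ^ (-a)) := by
  have := (Real.one_div_one_sub_rpow_hasFPowerSeriesOnBall_zero a).hasSum (y := x) (by
    rw [← ENNReal.ofReal_one, Metric.eball_ofReal]
    simp [abs_of_pos hx0, hx1])
  simp only [pc_eq_choose h, zero_add] at this
  rw [Real.rpow_neg (by linarith)]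
  simpa [FormalMultilinearSeries.ofScalars, mul_comm] using this

lemma pc_le {a : ℝ} (h : 0 < a) (h1 : a < 1) (n : ℕ) :
    pc a (n + 1) ≤ (1 / Real.Gamma a) * ((n + 1 : ℕ) : ℝ) ^ (a - 1) := by
  have hg := Real.Gamma_pos_of_pos h
  have hn : (0:ℝ) < (n + 1 : ℕ) := by positivity
  have hG := Real.Gamma_pos_of_pos hn
  have h2 := Real.Gamma_mul_add_mul_le_rpow_Gamma_mul_rpow_Gamma (s := (n + 1 : ℕ)) 
    (t := ((n + 1 : ℕ) : ℝ) + 1) (a := 1 - a) (b := a) hn (by positivity) (by linarith) h (by ring)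
  rw [show (1 - a) * ((n + 1 : ℕ) : ℝ) + a * (((n + 1 : ℕ) : ℝ) + 1) = a + (n + 1 : ℕ) by ring,
    Real.Gamma_add_one hn.ne', Real.mul_rpow hn.le hG.le, mul_left_comm, ← Real.rpow_add hG,
    sub_add_cancel, Real.rpow_one] at h2
  have hf : ((n + 1).factorial : ℝ) = ((n + 1 : ℕ) : ℝ) * Real.Gamma (n + 1 : ℕ) := by
    rw [← Real.Gamma_add_one hn.ne', Real.Gamma_nat_eq_factorial]
  unfold pc
  rw [hf, Real.rpow_sub hn, Real.rpow_one, div_div, div_le_iff₀ (by positivity)]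
  refine h2.trans (le_of_eq ?_)
  field_simp

lemma pc_tendsto {a : ℝ} (h : 0 < a) (h1 : a < 1) : Tendsto (pc a) atTop (𝓝 0) := by
  rw [← tendsto_add_atTop_iff_nat 1]
  have h2 : Tendsto (fun n : ℕ => (1 / Real.Gamma a) * ((n + 1 : ℕ) : ℝ) ^ (a - 1)) atTop
      (𝓝 ((1 / Real.Gamma a) * 0)) := by
    refine Tendsto.const_mul _ ?_
    have h3 := (tendsto_rpow_neg_atTop (show 0 < 1 - a by linarith)).comp
      (tendsto_natCast_atTop_atTop (R := ℝ))
    have h4 := h3.comp (tendsto_add_atTop_nat 1)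
    simpa [Function.comp_def] using h4
  rw [mul_zero] at h2
  exact squeeze_zero (fun n => (pc_pos h _).le) (fun n => pc_le h h1 n) h2

lemma summable_pc {a t : ℝ} (h : 0 < a) (h1 : a < 1) (ht : 0 < t) :
    Summable (fun n : ℕ => pc a n / (n + t)) := by
  rw [← summable_nat_add_iff 1]
  have h2 : Summable (fun n : ℕ => (1 / Real.Gamma a) * ((n + 1 : ℕ) : ℝ) ^ (a - 2)) := by
    refine Summable.mul_left _ ?_
    exact (summable_nat_add_iff 1).2 (Real.summable_nat_rpow.2 (by linarith))
  refine Summable.of_nonneg_of_le (fun n => ?_) (fun n => ?_) h2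
  · have := (pc_pos h (n + 1)).le
    positivity
  · have hn : (0:ℝ) < (n + 1 : ℕ) := by positivity
    have hg := Real.Gamma_pos_of_pos h
    calc pc a (n + 1) / (((n + 1 : ℕ) : ℝ) + t) 
        ≤ (1 / Real.Gamma a) * ((n + 1 : ℕ) : ℝ) ^ (a - 1) / ((n + 1 : ℕ) : ℝ) :=
          div_le_div₀ (by positivity) (pc_le h h1 n) hn (by linarith)
      _ = _ := by
        rw [mul_div_assoc]
        nth_rewrite 2 [← Real.rpow_one ((n + 1 : ℕ) : ℝ)]
        rw [← Real.rpow_sub hn]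
        ring_nf

lemma integral_series {c : ℕ → ℝ} {t : ℝ} (hc : ∀ n, 0 ≤ c n) (ht : 0 < t)
    (hs : Summable (fun n : ℕ => c n / (n + t))) :
    HasSum (fun n : ℕ => c n / (n + t)) (∫ x in (0:ℝ)..1, x ^ (t - 1) * ∑' n, c n * x ^ n) := by
  have hint : ∀ n : ℕ, IntervalIntegrable (fun x : ℝ => c n * x ^ (t - 1 + n)) volume 0 1 := by
    intro n
    have h0 : (0:ℝ) ≤ n := by positivity
    exact (intervalIntegral.intervalIntegrable_rpow' (by linarith)).const_mul _
  have hval : ∀ n : ℕ, ∫ x in (0:ℝ)..1, c n * x ^ (t - 1 + n) = c n / (n + t) := by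
    intro n
    have h0 : (0:ℝ) ≤ n := by positivity
    rw [intervalIntegral.integral_const_mul, integral_rpow (Or.inl (by linarith)),
      show t - 1 + n + 1 = n + t by ring, Real.one_rpow, Real.zero_rpow (by linarith)]
    ring
  have hI : ∀ n : ℕ, Integrable (fun x : ℝ => c n * x ^ (t - 1 + n)) (volume.restrict (Set.Ioc 0 1)) :=
    fun n => (intervalIntegrable_iff_integrableOn_Ioc_of_le (zero_le_one : (0:ℝ) ≤ 1)).1 (hint n)
  have hval' : ∀ n : ℕ, ∫ x in Set.Ioc (0:ℝ) 1, c n * x ^ (t - 1 + n) = c n / (n + t) := by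
    intro n
    rw [← hval n, intervalIntegral.integral_of_le (zero_le_one : (0:ℝ) ≤ 1)]
  have hnorm : ∀ n : ℕ, ∫ x in Set.Ioc (0:ℝ) 1, ‖c n * x ^ (t - 1 + n)‖ = c n / (n + t) := by
    intro n
    rw [← hval' n]
    refine setIntegral_congr_fun measurableSet_Ioc fun x hx => ?_
    have := Real.rpow_nonneg hx.1.le (t - 1 + n)
    have := hc n
    exact Real.norm_of_nonneg (by positivity)
  have key := hasSum_integral_of_summable_integral_norm hI (by simpa only [hnorm] using hs)
  simp only [hval'] at key
  rw [intervalIntegral.integral_of_le zero_le_one]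
  refine (congrArg (HasSum _) (Eq.symm ?_)).mp key
  refine setIntegral_congr_fun measurableSet_Ioc fun x hx => ?_
  rw [← tsum_mul_left]
  refine tsum_congr fun n => ?_
  rw [Real.rpow_add hx.1, Real.rpow_natCast]
  ring

lemma integral_beta {u v : ℝ} (hu : 0 < u) (hv : 0 < v) :
    ∫ x in (0:ℝ)..1, x ^ (u - 1) * (1 - x) ^ (v - 1) =
      Real.Gamma u * Real.Gamma v / Real.Gamma (u + v) := by
  have h := Complex.betaIntegral_eq_Gamma_mul_div (u : ℂ) v (by simpa) (by simpa)
  have h2 : Complex.betaIntegral u v =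
      ((∫ x in (0:ℝ)..1, x ^ (u - 1) * (1 - x) ^ (v - 1) : ℝ) : ℂ) := by
    rw [Complex.betaIntegral, ← intervalIntegral.integral_ofReal]
    refine intervalIntegral.integral_congr fun x hx => ?_
    rw [Set.uIcc_of_le zero_le_one] at hx
    push_cast
    rw [Complex.ofReal_cpow hx.1, Complex.ofReal_cpow (by linarith [hx.2])]
    push_cast
    rfl
  rw [h2, ← Complex.ofReal_add, Complex.Gamma_ofReal, Complex.Gamma_ofReal, Complex.Gamma_ofReal] at h
  exact_mod_cast h

lemma hasSum_beta {a t : ℝ} (h : 0 < a) (h1 : a < 1) (ht : 0 < t) :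
    HasSum (fun n : ℕ => pc a n / (n + t))
      (Real.Gamma t * Real.Gamma (1 - a) / Real.Gamma (t + (1 - a))) := by
  have h2 := integral_series (fun n => (pc_pos h n).le) ht (summable_pc h h1 ht)
  rw [← integral_beta ht (by linarith : 0 < 1 - a)]
  convert h2 using 1
  rw [intervalIntegral.integral_of_le zero_le_one, intervalIntegral.integral_of_le zero_le_one,
    integral_Ioc_eq_integral_Ioo, integral_Ioc_eq_integral_Ioo]
  refine setIntegral_congr_fun measurableSet_Ioo fun x hx => ?_
  rw [(hasSum_pc h hx.1 hx.2).tsum_eq]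
  ring_nf

lemma hasSum_shift {a s : ℝ} (h : 0 < a) (h1 : a < 1) (hs : -1 < s) (hs0 : s ≠ 0) :
    HasSum (fun n : ℕ => pc a (n + 1) / (n + 1 + s))
      ((-1 + (s + 1 - a) * (Real.Gamma (s + 1) * Real.Gamma (1 - a) /
        Real.Gamma (s + 1 + (1 - a)))) / s) := by
  have hb := (hasSum_beta h h1 (by linarith : 0 < s + 1)).mul_left (s + 1 - a)
  have hanti : ∀ n, pc a (n + 1) ≤ pc a n := by
    intro n
    have h3 := pc_succ h n
    have h4 := pc_pos h n
    have hn : (0:ℝ) < n + 1 := by positivity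
    refine le_of_mul_le_mul_right ?_ hn
    rw [h3]
    exact mul_le_mul_of_nonneg_left (by linarith) h4.le
  have htel : HasSum (fun n => pc a n - pc a (n + 1)) 1 := by
    rw [hasSum_iff_tendsto_nat_of_nonneg (fun n => sub_nonneg.2 (hanti n))]
    simp only [Finset.sum_range_sub', pc_zero h]
    simpa using (pc_tendsto h h1).const_sub 1
  have := (hb.sub htel).div_const s
  refine (congrArg₂ (fun f v => HasSum f v) (funext fun n => ?_) ?_).mp this
  · symm
    have h3 := pc_succ h n
    have hn : (0:ℝ) < n + 1 + s := by
      have : (0:ℝ) ≤ n := by positivity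
      linarith
    have hn' : (n:ℝ) + (s + 1) ≠ 0 := by linarith
    field_simp
    linear_combination (-(n + 1 + s)) * h3
  · ring

theorem integral_G (α ε : ℝ) (h0 : 0 < α) (h1 : α < 1) (hε0 : 0 < ε) (hε1 : ε < 1 - α) :
    (∫ x in (0:ℝ)..1, x ^ (-1 + α + ε) * ((hypergeomF α α (1 + α) x - 1) / x)) =
      (1 / (1 - α - ε)) *
        (1 - (α / (1 - ε)) * Real.Gamma (α + ε) * Real.Gamma (1 - α) / Real.Gamma ε -
          (α * Real.pi / Real.sin (α * Real.pi)) * (1 - α / (1 - ε))) := by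
  have hc : ∀ n : ℕ, (Real.Gamma (α + n) / Real.Gamma α) * (Real.Gamma (α + n) / Real.Gamma α) /
      ((Real.Gamma (1 + α + n) / Real.Gamma (1 + α)) * n.factorial) = pc α n * (α / (n + α)) := by
    intro n
    have e1 : Real.Gamma (1 + α + n) = (α + n) * Real.Gamma (α + n) := by
      rw [← Real.Gamma_add_one (by positivity)]; ring_nf
    have e2 : Real.Gamma (1 + α) = α * Real.Gamma α := by
      rw [← Real.Gamma_add_one (by positivity)]; ring_nf
    have g1 := Real.Gamma_pos_of_pos h0
    have g2 := Real.Gamma_pos_of_pos (show 0 < α + n by positivity)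
    rw [e1, e2, pc]
    have : (n.factorial : ℝ) ≠ 0 := by positivity
    have : (n : ℝ) + α ≠ 0 := by positivity
    have : α + (n : ℝ) ≠ 0 := by positivity
    field_simp
    ring
  have hcpos : ∀ n : ℕ, 0 ≤ pc α n * (α / (n + α)) := by
    intro n
    have := (pc_pos h0 n).le
    positivity
  have hs : HasSum (fun n : ℕ => pc α n / (n + α)) _ := hasSum_beta h0 h1 h0
  have hs1 := (hasSum_nat_add_iff' 1).2 hs
  have hs2 := hasSum_shift h0 h1 (show -1 < α + ε - 1 by linarith) (by linarith)
  have hS := ((hs2.sub hs1).mul_left (α / (1 - ε)))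
  have hfun : ∀ n : ℕ, α / (1 - ε) * (pc α (n + 1) / (n + 1 + (α + ε - 1)) -
      pc α (n + 1) / ((n + 1 : ℕ) + α)) =
      (pc α (n + 1) * (α / ((n + 1 : ℕ) + α))) / (n + (α + ε)) := by
    intro n
    have e1 : (1 - ε) ≠ 0 := by linarith
    have hn : (0:ℝ) ≤ n := by positivity
    have e2 : (n:ℝ) + 1 + (α + ε - 1) ≠ 0 := by linarith
    have e3 : (n:ℝ) + (α + ε) ≠ 0 := by positivity
    have e4 : (n:ℝ) + 1 + α ≠ 0 := by positivity
    push_cast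
    field_simp
    ring
  simp only [hfun] at hS
  have hI := integral_series (t := α + ε) (fun n => hcpos (n + 1)) (by linarith) hS.summable
  have hval := hI.unique hS
  have hG : ∫ x in (0:ℝ)..1, x ^ (-1 + α + ε) * ((hypergeomF α α (1 + α) x - 1) / x) =
      ∫ x in (0:ℝ)..1, x ^ (α + ε - 1) *
        ∑' n : ℕ, (pc α (n + 1) * (α / ((n + 1 : ℕ) + α))) * x ^ n := by
    rw [intervalIntegral.integral_of_le zero_le_one, intervalIntegral.integral_of_le zero_le_one,
      integral_Ioc_eq_integral_Ioo, integral_Ioc_eq_integral_Ioo]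
    refine setIntegral_congr_fun measurableSet_Ioo fun x hx => ?_
    have hx0 := hx.1
    simp only [hypergeomF, hc]
    have hsum : Summable fun n : ℕ => pc α n * (α / (n + α)) * x ^ n := by
      refine Summable.of_nonneg_of_le (fun n => mul_nonneg (hcpos n) (by positivity)) (fun n => ?_)
        (hasSum_pc h0 hx.1 hx.2).summable
      have h5 : α / (n + α) ≤ 1 := by
        rw [div_le_one (by positivity)]
        have hn : (0:ℝ) ≤ n := by positivity
        linarith
      have := (pc_pos h0 n).le
      gcongr
      exact mul_le_of_le_one_right this h5
    rw [hsum.tsum_eq_zero_add]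
    have e0 : pc α 0 * (α / ((0 : ℕ) + α)) * x ^ 0 = 1 := by
      simp [pc_zero h0, h0.ne']
    rw [e0, add_sub_cancel_left, ← tsum_div_const]
    congr 1
    · ring_nf
    · refine tsum_congr fun n => ?_
      field_simp
      ring
  rw [hG, hval]
  have hrefl := Real.Gamma_mul_Gamma_one_sub α
  rw [show α + ε - 1 + 1 = α + ε by ring, show α + ε + (1 - α) = ε + 1 by ring,
    Real.Gamma_add_one hε0.ne', hrefl, show α + (1 - α) = 1 by ring, Real.Gamma_one, mul_comm α π]
  have g := (Real.Gamma_pos_of_pos hε0).ne'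
  have hsin : Real.sin (π * α) ≠ 0 := by
    refine (Real.sin_pos_of_pos_of_lt_pi (by positivity) ?_).ne'
    nlinarith [Real.pi_pos]
  have e1 : (1 - ε) ≠ 0 := by linarith
  have e2 : (1 - α - ε) ≠ 0 := by linarith
  have e3 : (α + ε - 1) = -(1 - α - ε) := by ring
  rw [e3]
  simp only [Finset.sum_range_one, pc_zero h0, Nat.cast_zero, zero_add, div_one]
  generalize Real.sin (π * α) = S at *
  generalize Real.Gamma ε = E at *
  field_simp
  ring
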